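/- Let n ≥ 1 and let I be a radical ideal of the polynomial ring ℂ[x₁,…,xₙ]. Then the ideal I·ℂ⟦x₁,…,xₙ⟧ generated by I in the ring of formal power series in n variables over ℂ is a radical ideal. -/

import Mathlib

open scoped TensorProduct

theorem isReduced_tensorProduct_of_finite_of_flat (A B S : Type*) [CommRing A] [IsDomain A]
    [CharZero A] [CommRing B] [IsDomain B] [Algebra A B] [Module.Finite A B] [FaithfulSMul A B]
    [CommRing S] [IsDomain S] [Algebra A S] [Module.Flat A S] :
    IsReduced (B ⊗[A] S) := by
  let F := FractionRing A
  let K := FractionRing B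
  let L := FractionRing S
  let : Algebra F K := FractionRing.liftAlgebra A K
  have : CharZero F := inferInstance
  have : Algebra.IsAlgebraic F K := inferInstance
  have : Algebra.IsSeparable F K := inferInstance
  have : Algebra.FormallyUnramified F K := .of_isSeparable F K
  have : Algebra.FormallyUnramified A F := inferInstance
  have : Algebra.FormallyUnramified A K := .comp A F K
  have : Algebra.EssFiniteType A K := .comp A B K
  have : Module.Flat A K := .trans A F K
  have : IsReduced (L ⊗[A] K) := Algebra.FormallyUnramified.isReduced_of_field L _
  have h₁ : Function.Injective
      (Algebra.TensorProduct.map (IsScalarTower.toAlgHom A B K) (.id A S)) :=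
    Module.Flat.rTensor_preserves_injective_linearMap (M := S)
      (IsScalarTower.toAlgHom A B K).toLinearMap (IsFractionRing.injective B K)
  have h₂ : Function.Injective
      (Algebra.TensorProduct.map (.id A K) (IsScalarTower.toAlgHom A S L)) :=
    Module.Flat.lTensor_preserves_injective_linearMap (M := K)
      (IsScalarTower.toAlgHom A S L).toLinearMap (IsFractionRing.injective S L)
  exact isReduced_of_injective (((Algebra.TensorProduct.comm A K L).toAlgHom.comp
    (Algebra.TensorProduct.map (.id A K) (IsScalarTower.toAlgHom A S L))).comp
    (Algebra.TensorProduct.map (IsScalarTower.toAlgHom A B K) (.id A S)))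
    (((Algebra.TensorProduct.comm A K L).injective.comp h₂).comp h₁)

theorem isPrecomplete_of_finite {R M : Type*} [CommRing R] (I : Ideal R) [IsPrecomplete I R]
    [AddCommGroup M] [Module R M] [Module.Finite R M] : IsPrecomplete I M := by
  rw [← AdicCompletion.of_surjective_iff]
  intro y
  obtain ⟨t, rfl⟩ := AdicCompletion.ofTensorProduct_surjective_of_finite I M y
  induction t with
  | zero => exact ⟨0, by simp⟩
  | add s t hs ht =>
    obtain ⟨x, hx⟩ := hs
    obtain ⟨z, hz⟩ := ht
    exact ⟨x + z, by simp [hx, hz]⟩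
  | tmul a x =>
    obtain ⟨r, rfl⟩ := AdicCompletion.of_surjective I R a
    exact ⟨r • x, by
      rw [AdicCompletion.ofTensorProduct_tmul, map_smul]
      exact (algebraMap_smul (AdicCompletion I R) r (AdicCompletion.of I M x)).symm⟩

theorem Ideal.map_inf_of_flat {R : Type*} (S : Type*) [CommRing R] [CommRing S] [Algebra R S]
    [Module.Flat R S] (I J : Ideal R) :
    (I ⊓ J).map (algebraMap R S) = I.map (algebraMap R S) ⊓ J.map (algebraMap R S) := by
  refine le_antisymm (Ideal.map_inf_le _) ?_
  rintro x ⟨hI, hJ⟩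
  have key (K : Ideal R) (x : S) (hx : x ∈ K.map (algebraMap R S)) :
      ∃ a : S →₀ R, (∀ i, a i ∈ K) ∧ ∑ i : a.support, a i • (i : S) = x := by
    have hx' : x ∈ K • Submodule.span R (Set.range (id : S → S)) := by
      rwa [Set.range_id, Submodule.span_univ, Ideal.smul_top_eq_map]
    obtain ⟨a, ha, rfl⟩ := (Submodule.mem_ideal_smul_span_iff_exists_sum _ _ _).mp hx'
    exact ⟨a, ha, Finset.sum_coe_sort a.support fun i ↦ a i • i⟩
  obtain ⟨a, ha, rfl⟩ := key I x hI
  obtain ⟨b, hb, hab⟩ := key J _ hJ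
  have h0 : ∑ i, Sum.elim (fun i : a.support ↦ a i) (fun i : b.support ↦ b i) i •
      Sum.elim (fun i : a.support ↦ (i : S)) (fun i : b.support ↦ -(i : S)) i = 0 := by
    rw [Fintype.sum_sum_type]
    simp only [Sum.elim_inl, Sum.elim_inr, smul_neg, Finset.sum_neg_distrib, hab, add_neg_cancel]
  obtain ⟨m, c, y, hc, hc'⟩ :=
    Module.Flat.isTrivialRelation_of_sum_smul_eq_zero (R := R) (M := S) h0
  have h1 : ∑ i : a.support, a i • (i : S) =
      ∑ j, (∑ i : a.support, a i * c (.inl i) j) • y j := by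
    simp_rw [Finset.sum_smul, mul_smul]
    rw [Finset.sum_comm]
    refine Finset.sum_congr rfl fun i _ ↦ ?_
    rw [← Finset.smul_sum]
    exact congrArg _ (hc (.inl i))
  rw [h1]
  refine Ideal.sum_mem _ fun j _ ↦ ?_
  rw [Algebra.smul_def]
  refine Ideal.mul_mem_right _ _ (Ideal.mem_map_of_mem _ ⟨?_, ?_⟩)
  · exact Ideal.sum_mem _ fun i _ ↦ Ideal.mul_mem_right _ _ (ha _)
  · have := hc' j
    simp only [Fintype.sum_sum_type, Sum.elim_inl, Sum.elim_inr] at this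
    rw [eq_neg_of_add_eq_zero_left this]
    exact J.neg_mem (Ideal.sum_mem _ fun i _ ↦ Ideal.mul_mem_right _ _ (hb _))

section

open IsLocalRing

variable {A B S C : Type*} [CommRing A] [CommRing B] [CommRing S] [CommRing C]
  [Algebra A B] [Algebra A S] [Algebra A C] [Algebra B C] [Algebra S C]
  [IsScalarTower A B C] [IsScalarTower A S C]

theorem exists_sub_tmul_mem_pow (n : Ideal A) (m : Ideal B) (hnm : n.map (algebraMap A B) ≤ m)
    (hS : ∀ i (s : S), ∃ a : A, s - algebraMap A S a ∈ n.map (algebraMap A S) ^ i) (i : ℕ)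
    (z : B ⊗[A] S) :
    ∃ b : B, z - algebraMap B (B ⊗[A] S) b ∈ m.map (algebraMap B (B ⊗[A] S)) ^ i := by
  induction z with
  | zero => exact ⟨0, by simp⟩
  | add x y hx hy =>
    obtain ⟨b, hb⟩ := hx
    obtain ⟨c, hc⟩ := hy
    exact ⟨b + c, by simpa only [map_add, add_sub_add_comm] using add_mem hb hc⟩
  | tmul b s =>
    obtain ⟨a, ha⟩ := hS i s
    refine ⟨a • b, ?_⟩
    have hle : (n.map (algebraMap A S)).map (Algebra.TensorProduct.includeRight (R := A) (A := B)) ≤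
        m.map (algebraMap B (B ⊗[A] S)) := by
      rw [Ideal.map_le_iff_le_comap, Ideal.map_le_iff_le_comap]
      intro x hx
      rw [Ideal.mem_comap, Ideal.mem_comap, AlgHom.commutes,
        IsScalarTower.algebraMap_apply A B (B ⊗[A] S)]
      exact Ideal.mem_map_of_mem _ (hnm (Ideal.mem_map_of_mem _ hx))
    have h1 := Ideal.mem_map_of_mem (Algebra.TensorProduct.includeRight (R := A) (A := B)) ha
    rw [Ideal.map_pow] at h1
    have h2 := Ideal.mul_mem_left _ (b ⊗ₜ[A] (1 : S)) (Ideal.pow_right_mono hle i h1)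
    convert h2 using 1
    simp [TensorProduct.tmul_sub, mul_sub, Algebra.TensorProduct.algebraMap_apply,
      Algebra.algebraMap_eq_smul_one (A := S), TensorProduct.smul_tmul']

variable (A B S C) in
/-- Descent of reducedness along `B ⊗[A] S → C`, where `S` is complete for the maximal ideal `n` of
`A` and `C` has the same quotients modulo powers of `m` as the finite `A`-algebra `B`. The map is
surjective and every element of its kernel is killed by some `1 - r` with `r ∈ m (B ⊗[A] S)`. -/
theorem isReduced_of_isReduced_tensorProduct [Module.Finite A B] [IsNoetherianRing S]
    [IsNoetherianRing C] [IsLocalRing C] [IsReduced (B ⊗[A] S)]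
    (n : Ideal A) [n.IsMaximal] (m : Ideal B) (hm : m = (maximalIdeal C).comap (algebraMap B C))
    (hnm : n.map (algebraMap A B) ≤ m)
    [IsPrecomplete (n.map (algebraMap A S)) S]
    (hS : ∀ i (s : S), ∃ a : A, s - algebraMap A S a ∈ n.map (algebraMap A S) ^ i)
    (hC : ∀ i (c : C), ∃ b : B, c - algebraMap B C b ∈ m.map (algebraMap B C) ^ i)
    (hmC : ∀ i (b : B), algebraMap B C b ∈ m.map (algebraMap B C) ^ i → b ∈ m ^ i) :
    IsReduced C := by
  let φ : B ⊗[A] S →ₐ[B] C := Algebra.TensorProduct.lift (Algebra.ofId B C)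
    (IsScalarTower.toAlgHom A S C) fun _ _ ↦ Commute.all _ _
  have hφB (b : B) : φ (algebraMap B _ b) = algebraMap B C b := φ.commutes b
  have hmC' : m.map (algebraMap B C) ≤ maximalIdeal C := Ideal.map_le_iff_le_comap.mpr hm.le
  have hφm : (m.map (algebraMap B (B ⊗[A] S))).map φ = m.map (algebraMap B C) := by
    rw [← φ.comp_algebraMap, ← Ideal.map_map]
    rfl
  have hpow : ∃ k, m.map (algebraMap B C) ^ k ≤ n.map (algebraMap A C) := by
    refine Ideal.exists_pow_le_of_le_radical_of_fg ?_ (IsNoetherian.noetherian _)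
    rw [Ideal.radical_eq_sInf]
    refine le_sInf fun Q ⟨hnQ, hQ⟩ ↦ ?_
    have hq : (Q.comap (algebraMap B C)).IsMaximal := by
      refine Ideal.isMaximal_of_isIntegral_of_isMaximal_comap (R := A) _ ?_
      rw [Ideal.comap_comap, ← IsScalarTower.algebraMap_eq]
      have : n = Q.comap (algebraMap A C) :=
        Ideal.IsMaximal.eq_of_le ‹_› (Ideal.comap_ne_top _ hQ.ne_top)
          (Ideal.map_le_iff_le_comap.mp hnQ)
      exact this ▸ ‹n.IsMaximal›
    rw [Ideal.map_le_iff_le_comap]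
    refine (hq.eq_of_le (hm ▸ Ideal.comap_ne_top _ (maximalIdeal.isMaximal C).ne_top) ?_).ge
    exact hm ▸ Ideal.comap_mono (le_maximalIdeal hQ.ne_top)
  have hsurj : Function.Surjective φ := by
    let ψ : S ⊗[A] B →ₐ[S] C := Algebra.TensorProduct.lift (Algebra.ofId S C)
      (IsScalarTower.toAlgHom A B C) fun _ _ ↦ Commute.all _ _
    have hle : (n.map (algebraMap A S)).map (algebraMap S C) ≤ m.map (algebraMap B C) := by
      rw [Ideal.map_map, ← IsScalarTower.algebraMap_eq, IsScalarTower.algebraMap_eq A B C,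
        ← Ideal.map_map]
      exact Ideal.map_mono hnm
    have : IsPrecomplete (n.map (algebraMap A S)) (S ⊗[A] B) := isPrecomplete_of_finite _
    have : IsHausdorff (n.map (algebraMap A S)) C := by
      rw [← IsHausdorff.map_algebraMap_iff (S := C)]
      exact .of_isLocalRing _ _
        ((hle.trans hmC').trans_lt (maximalIdeal.isMaximal C).ne_top.lt_top).ne
    have hψ : Function.Surjective ψ.toLinearMap := by
      refine surjective_of_mkQ_comp_surjective (I := n.map (algebraMap A S)) fun y ↦ ?_
      obtain ⟨c, rfl⟩ := Submodule.mkQ_surjective _ y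
      obtain ⟨k, hk⟩ := hpow
      obtain ⟨b, hb⟩ := hC k c
      refine ⟨1 ⊗ₜ b, ?_⟩
      rw [LinearMap.comp_apply, eq_comm, ← sub_eq_zero, ← map_sub, Submodule.mkQ_apply,
        Submodule.Quotient.mk_eq_zero, Ideal.smul_top_eq_map, Submodule.restrictScalars_mem,
        Ideal.map_map, ← IsScalarTower.algebraMap_eq]
      simpa [ψ] using hk hb
    have hφψ : (φ.restrictScalars A).comp (Algebra.TensorProduct.comm A S B).toAlgHom =
        ψ.restrictScalars A := by
      ext <;> simp [φ, ψ]
    intro c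
    obtain ⟨x, rfl⟩ := hψ c
    exact ⟨Algebra.TensorProduct.comm A S B x, DFunLike.congr_fun hφψ x⟩
  have hker (z : B ⊗[A] S) (hz : φ z = 0) : ∃ r ∈ m.map (algebraMap B (B ⊗[A] S)), r * z = z := by
    have : IsNoetherianRing (B ⊗[A] S) :=
      have : IsNoetherianRing (S ⊗[A] B) := .of_finite S _
      isNoetherianRing_of_ringEquiv _ (Algebra.TensorProduct.comm A S B).toRingEquiv
    have := (Ideal.mem_iInf_smul_pow_eq_bot_iff (m.map (algebraMap B (B ⊗[A] S))) z).mp ?_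
    · obtain ⟨r, hr⟩ := this
      exact ⟨r, r.2, hr⟩
    rw [Submodule.mem_iInf]
    intro i
    obtain ⟨b, hb⟩ := exists_sub_tmul_mem_pow n m hnm hS i z
    have hb' := Ideal.mem_map_of_mem φ hb
    rw [Ideal.map_pow, hφm, map_sub, hz, zero_sub, neg_mem_iff, hφB] at hb'
    have := Ideal.mem_map_of_mem (algebraMap B (B ⊗[A] S)) (hmC i b hb')
    rw [Ideal.map_pow] at this
    simpa using add_mem hb this
  rw [isReduced_iff]
  rintro c ⟨k, hk⟩
  obtain ⟨d, rfl⟩ := hsurj c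
  obtain ⟨r, hr, hrd⟩ := hker (d ^ k) (by rw [map_pow, hk])
  have hnil : IsNilpotent ((1 - r) * d) := ⟨k + 1, by
    rw [mul_pow, pow_succ (1 - r), pow_succ d,
      show (1 - r) ^ k * (1 - r) * (d ^ k * d) = (1 - r) ^ k * d * (d ^ k - r * d ^ k) by ring, hrd,
      sub_self, mul_zero]⟩
  have h0 := congrArg φ hnil.eq_zero
  rw [map_mul, map_sub, map_one, map_zero] at h0
  have hr' : φ r ∈ maximalIdeal C := hmC' (hφm ▸ Ideal.mem_map_of_mem φ hr)
  have : IsUnit (1 - φ r) := by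
    by_contra h
    exact (maximalIdeal C).one_notMem (by simpa using add_mem ((mem_maximalIdeal _).mpr h) hr')
  exact this.mul_right_eq_zero.mp h0

end

namespace MvPowerSeries

theorem exists_sub_algebraMap_mem_pow {σ R : Type*} [Finite σ] [CommRing R] (i : ℕ)
    (f : MvPowerSeries σ R) : ∃ p : MvPolynomial σ R, f - algebraMap _ _ p ∈
      (MvPolynomial.idealOfVars σ R).map (algebraMap _ (MvPowerSeries σ R)) ^ i := by
  let e := toAdicCompletionAlgEquiv σ R
  refine ⟨truncTotal i f, ?_⟩
  have h : e (f - algebraMap _ _ (truncTotal i f)) ∈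
      (MvPolynomial.idealOfVars σ R ^ i • ⊤ : Submodule (MvPolynomial σ R) _) := by
    rw [AdicCompletion.pow_smul_top_eq_ker_eval (MvPolynomial.idealOfVars_fg σ R), map_sub,
      AlgEquiv.commutes, LinearMap.mem_ker, map_sub, sub_eq_zero]
    rfl
  rw [Ideal.smul_top_eq_map, Submodule.restrictScalars_mem] at h
  have hg := Ideal.mem_map_of_mem e.symm.toAlgHom.toRingHom h
  rw [Ideal.map_map, AlgHom.toRingHom_eq_coe, AlgHom.comp_algebraMap, Ideal.map_pow] at hg
  simpa using hg

theorem flat_mvPolynomial {σ R : Type*} [Finite σ] [CommRing R] [IsNoetherianRing R] :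
    Module.Flat (MvPolynomial σ R) (MvPowerSeries σ R) :=
  .of_linearEquiv (toAdicCompletionAlgEquiv σ R).toLinearEquiv

theorem isPrecomplete_map_idealOfVars {σ R : Type*} [Finite σ] [CommRing R] :
    IsPrecomplete ((MvPolynomial.idealOfVars σ R).map (algebraMap _ (MvPowerSeries σ R)))
      (MvPowerSeries σ R) := by
  have : (MvPolynomial.idealOfVars σ R).map (algebraMap _ (MvPowerSeries σ R)) =
      .span (.range X) := by
    rw [MvPolynomial.idealOfVars, Ideal.map_span, ← Set.range_comp]
    congr 2
    ext1 i
    exact MvPolynomial.coe_X i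
  rw [this]
  infer_instance

theorem mem_of_algebraMap_mem_map {σ R : Type*} [Finite σ] [CommRing R] {i : ℕ}
    {J : Ideal (MvPolynomial σ R)} (hJ : MvPolynomial.idealOfVars σ R ^ i ≤ J)
    {p : MvPolynomial σ R} (hp : algebraMap _ (MvPowerSeries σ R) p ∈ J.map (algebraMap _ _)) :
    p ∈ J := by
  have h := Ideal.mem_map_of_mem (truncTotalAlgHom σ R i).toRingHom hp
  rw [Ideal.map_map, AlgHom.toRingHom_eq_coe, AlgHom.comp_algebraMap] at h
  have h' : Ideal.Quotient.mk (MvPolynomial.idealOfVars σ R ^ i) p ∈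
      J.map (Ideal.Quotient.mk (MvPolynomial.idealOfVars σ R ^ i)) := by
    simpa using h
  rwa [Ideal.mem_quotient_iff_mem_sup, sup_of_le_left hJ] at h'

theorem mem_idealOfVars_iff {σ R : Type*} [CommRing R] {p : MvPolynomial σ R} :
    p ∈ MvPolynomial.idealOfVars σ R ↔ MvPolynomial.constantCoeff p = 0 := by
  rw [← pow_one (MvPolynomial.idealOfVars σ R), MvPolynomial.mem_pow_idealOfVars_iff']
  simp [MvPolynomial.constantCoeff_eq, Finsupp.degree_eq_zero_iff]

theorem isMaximal_idealOfVars {σ k : Type*} [Field k] :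
    (MvPolynomial.idealOfVars σ k).IsMaximal := by
  have : MvPolynomial.idealOfVars σ k =
      RingHom.ker (MvPolynomial.constantCoeff (σ := σ) (R := k)) :=
    Ideal.ext fun p ↦ mem_idealOfVars_iff
  rw [this]
  exact RingHom.ker_isMaximal_of_surjective _ fun c ↦ ⟨.C c, MvPolynomial.constantCoeff_C ..⟩

theorem mem_maximalIdeal_iff {σ k : Type*} [Field k] {f : MvPowerSeries σ k} :
    f ∈ IsLocalRing.maximalIdeal (MvPowerSeries σ k) ↔ constantCoeff f = 0 := by
  simp [isUnit_iff_constantCoeff]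

end MvPowerSeries

namespace MvPolynomial

/-- The automorphism of a polynomial ring sending `X i` to `X i - C (c i)`. -/
noncomputable def translateEquiv {σ R : Type*} [CommRing R] (c : σ → R) :
    MvPolynomial σ R ≃ₐ[R] MvPolynomial σ R :=
  AlgEquiv.ofAlgHom (aeval fun i ↦ X i - C (c i)) (aeval fun i ↦ X i + C (c i))
    (by ext; simp [algHom_C]) (by ext; simp [algHom_C])

/-- Noether normalisation with coordinates in the kernel of a given augmentation. -/
theorem exists_finite_injective_aeval {k B : Type*} [Field k] [CommRing B] [Nontrivial B]
    [Algebra k B] [Algebra.FiniteType k B] (ε : B →ₐ[k] k) :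
    ∃ (s : ℕ) (b : Fin s → B), (∀ i, ε (b i) = 0) ∧
      Function.Injective (aeval (R := k) b) ∧ (aeval (R := k) b).Finite := by
  obtain ⟨s, g, hg, hfin⟩ := exists_finite_inj_algHom_of_fg k B
  let c (i : Fin s) : k := ε (g (X i))
  have h : aeval (R := k) (fun i ↦ g (X i) - algebraMap k B (c i)) =
      g.comp (translateEquiv c).toAlgHom := by
    ext i
    simp [translateEquiv, algHom_C]
  refine ⟨s, fun i ↦ g (X i) - algebraMap k B (c i), fun i ↦ by simp [c], ?_, ?_⟩
  · rw [h]
    exact hg.comp (translateEquiv c).injective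
  · rw [h]
    exact hfin.comp (.of_surjective _ (translateEquiv c).surjective)

end MvPolynomial

open IsLocalRing in
theorem isReduced_of_exists_ringHom_mvPowerSeries {k B C : Type*} [Field k] [CharZero k]
    [CommRing B] [IsDomain B] [Algebra k B] [Algebra.FiniteType k B] [CommRing C] [IsLocalRing C]
    [IsNoetherianRing C] [Algebra B C] (ε : B →ₐ[k] k) (m : Ideal B)
    (hm : m = (maximalIdeal C).comap (algebraMap B C)) (hε : ∀ b, ε b = 0 → b ∈ m)
    (hψ : ∀ s (b : Fin s → B), (∀ i, ε (b i) = 0) → ∃ ψ : MvPowerSeries (Fin s) k →+* C,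
      ψ.comp (algebraMap (MvPolynomial (Fin s) k) _) =
        (algebraMap B C).comp (MvPolynomial.aeval b).toRingHom)
    (hC : ∀ i (c : C), ∃ b : B, c - algebraMap B C b ∈ m.map (algebraMap B C) ^ i)
    (hmC : ∀ i (b : B), algebraMap B C b ∈ m.map (algebraMap B C) ^ i → b ∈ m ^ i) :
    IsReduced C := by
  obtain ⟨s, b, hb, hinj, hfin⟩ := MvPolynomial.exists_finite_injective_aeval ε
  obtain ⟨ψ, hψ⟩ := hψ s b hb
  algebraize [(MvPolynomial.aeval (R := k) b).toRingHom, ψ,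
    (algebraMap B C).comp (MvPolynomial.aeval (R := k) b).toRingHom]
  have : IsScalarTower (MvPolynomial (Fin s) k) (MvPowerSeries (Fin s) k) C :=
    .of_algebraMap_eq' hψ.symm
  have : Module.Finite (MvPolynomial (Fin s) k) B := hfin
  have : FaithfulSMul (MvPolynomial (Fin s) k) B :=
    (faithfulSMul_iff_algebraMap_injective _ B).mpr hinj
  have := MvPowerSeries.flat_mvPolynomial (σ := Fin s) (R := k)
  have : IsDomain (MvPowerSeries (Fin s) k) := NoZeroDivisors.to_isDomain _
  have := isReduced_tensorProduct_of_finite_of_flat (MvPolynomial (Fin s) k) B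
    (MvPowerSeries (Fin s) k)
  have := MvPowerSeries.isMaximal_idealOfVars (σ := Fin s) (k := k)
  have := MvPowerSeries.isPrecomplete_map_idealOfVars (σ := Fin s) (R := k)
  refine isReduced_of_isReduced_tensorProduct (MvPolynomial (Fin s) k) B (MvPowerSeries (Fin s) k)
    C (MvPolynomial.idealOfVars (Fin s) k) m hm ?_ MvPowerSeries.exists_sub_algebraMap_mem_pow
    hC hmC
  rw [MvPolynomial.idealOfVars, Ideal.map_span, Ideal.span_le]
  rintro _ ⟨_, ⟨i, rfl⟩, rfl⟩
  refine hε _ ?_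
  rw [← hb i]
  exact congrArg ε (MvPolynomial.aeval_X b i)

open IsLocalRing in
theorem isRadical_map_of_isPrime {σ k : Type*} [Finite σ] [Field k] [CharZero k]
    (P : Ideal (MvPolynomial σ k)) [P.IsPrime] :
    (P.map (algebraMap _ (MvPowerSeries σ k))).IsRadical := by
  by_cases hP : ∀ p ∈ P, MvPolynomial.constantCoeff p = 0
  swap
  · push Not at hP
    obtain ⟨p, hp, hp0⟩ := hP
    have hu : IsUnit (algebraMap _ (MvPowerSeries σ k) p) := by
      rw [MvPowerSeries.isUnit_iff_constantCoeff, isUnit_iff_ne_zero]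
      exact hp0
    rw [Ideal.eq_top_of_isUnit_mem _ (Ideal.mem_map_of_mem _ hp) hu]
    exact fun _ _ ↦ trivial
  let R := MvPolynomial σ k
  let T := MvPowerSeries σ k
  let B := R ⧸ P
  let C := T ⧸ P.map (algebraMap R T)
  let π : R →+* B := Ideal.Quotient.mk P
  let ϖ : T →+* C := Ideal.Quotient.mk (P.map (algebraMap R T))
  have hϖπ : (algebraMap B C).comp π = ϖ.comp (algebraMap R T) := rfl
  have hPT : P.map (algebraMap R T) ≤ maximalIdeal T :=
    Ideal.map_le_iff_le_comap.mpr fun p hp ↦ MvPowerSeries.mem_maximalIdeal_iff.mpr (hP p hp)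
  have : Nontrivial C := Ideal.Quotient.nontrivial_iff.mpr
    (hPT.trans_lt (maximalIdeal.isMaximal T).ne_top.lt_top).ne
  have : IsLocalRing C := .of_surjective' ϖ Ideal.Quotient.mk_surjective
  let m : Ideal B := (maximalIdeal C).comap (algebraMap B C)
  have hπm (p : R) : π p ∈ m ↔ MvPolynomial.constantCoeff p = 0 := by
    have h : (maximalIdeal C).comap ϖ = maximalIdeal T :=
      eq_maximalIdeal (Ideal.comap_isMaximal_of_surjective ϖ Ideal.Quotient.mk_surjective)
    change algebraMap R T p ∈ (maximalIdeal C).comap ϖ ↔ _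
    rw [h]
    exact MvPowerSeries.mem_maximalIdeal_iff
  have hm : m = (MvPolynomial.idealOfVars σ k).map π := by
    refine le_antisymm (fun b hb ↦ ?_) (Ideal.map_le_iff_le_comap.mpr fun p hp ↦
      (hπm p).mpr (MvPowerSeries.mem_idealOfVars_iff.mp hp))
    obtain ⟨p, rfl⟩ := Ideal.Quotient.mk_surjective b
    exact Ideal.mem_map_of_mem _ (MvPowerSeries.mem_idealOfVars_iff.mpr ((hπm p).mp hb))
  have hmC : m.map (algebraMap B C) =
      ((MvPolynomial.idealOfVars σ k).map (algebraMap R T)).map ϖ := by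
    rw [hm, Ideal.map_map, hϖπ, ← Ideal.map_map]
  let ε : B →ₐ[k] k := Ideal.Quotient.liftₐ P (MvPolynomial.aeval 0) fun p hp ↦ by
    rw [← hP p hp, MvPolynomial.aeval_zero]; rfl
  have hεm (x : B) (hx : ε x = 0) : x ∈ m := by
    obtain ⟨p, rfl⟩ := Ideal.Quotient.mk_surjective x
    refine (hπm p).mpr ?_
    rw [← hx]
    exact (MvPolynomial.aeval_zero p).symm
  rw [Ideal.isRadical_iff_quotient_reduced]
  refine isReduced_of_exists_ringHom_mvPowerSeries ε m rfl hεm ?_ ?_ ?_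
  · intro s b hb
    choose p hp using fun i ↦ Ideal.Quotient.mk_surjective (I := P) (b i)
    have hp0 (i) : MvPolynomial.constantCoeff (p i) = 0 := by
      rw [← hb i, ← hp i]
      exact (MvPolynomial.aeval_zero (p i)).symm
    have ha : MvPowerSeries.HasSubst fun i ↦ algebraMap R T (p i) :=
      MvPowerSeries.hasSubst_of_constantCoeff_zero hp0
    refine ⟨ϖ.comp (MvPowerSeries.substAlgHom (R := k) ha).toRingHom,
      MvPolynomial.ringHom_ext (fun c ↦ ?_) fun i ↦ ?_⟩
    · have h : algebraMap k T c = algebraMap R T (.C c) := (MvPolynomial.coe_C c).symm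
      refine (congrArg ϖ (((MvPowerSeries.substAlgHom_coe ha (.C c)).trans
        (MvPolynomial.aeval_C _ c)).trans h)).trans ?_
      exact (congrArg (algebraMap B C) (MvPolynomial.aeval_C b c)).symm
    · refine (congrArg ϖ ((MvPowerSeries.substAlgHom_coe ha (.X i)).trans
        (MvPolynomial.aeval_X _ i))).trans ?_
      exact (congrArg (algebraMap B C) ((MvPolynomial.aeval_X b i).trans (hp i).symm)).symm
  · intro i c
    obtain ⟨f, rfl⟩ := Ideal.Quotient.mk_surjective c
    obtain ⟨q, hq⟩ := MvPowerSeries.exists_sub_algebraMap_mem_pow i f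
    refine ⟨π q, ?_⟩
    have h := Ideal.mem_map_of_mem ϖ hq
    rwa [Ideal.map_pow, ← hmC, map_sub] at h
  · intro i b hb
    obtain ⟨q, rfl⟩ := Ideal.Quotient.mk_surjective b
    rw [hmC, ← Ideal.map_pow, ← Ideal.map_pow] at hb
    change ϖ (algebraMap R T q) ∈ _ at hb
    rw [Ideal.mem_quotient_iff_mem_sup, ← Ideal.map_sup] at hb
    have := MvPowerSeries.mem_of_algebraMap_mem_map le_sup_left hb
    rwa [hm, ← Ideal.map_pow, Ideal.mem_quotient_iff_mem_sup]

theorem isRadical_map_of_isRadical {σ k : Type*} [Finite σ] [Field k] [CharZero k]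
    (I : Ideal (MvPolynomial σ k)) (hI : I.IsRadical) :
    (I.map (algebraMap _ (MvPowerSeries σ k))).IsRadical := by
  have : Module.Flat (MvPolynomial σ k) (MvPowerSeries σ k) := MvPowerSeries.flat_mvPolynomial
  have key (s : Finset (Ideal (MvPolynomial σ k))) (hs : ∀ P ∈ s, P.IsPrime) :
      ((s.inf id).map (algebraMap _ (MvPowerSeries σ k))).IsRadical := by
    classical
    induction s using Finset.induction_on with
    | empty =>
      rw [Finset.inf_empty, Ideal.map_top]
      exact fun _ _ ↦ trivial
    | insert P s _ ih =>
      rw [Finset.inf_insert, id, Ideal.map_inf_of_flat]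
      have := hs P (Finset.mem_insert_self P s)
      exact (isRadical_map_of_isPrime P).inf (ih fun Q hQ ↦ hs Q (Finset.mem_insert_of_mem hQ))
  have hfin := I.finite_minimalPrimes_of_isNoetherianRing (MvPolynomial σ k)
  have := key hfin.toFinset fun P hP ↦ (hfin.mem_toFinset.mp hP).1.1
  rwa [Finset.inf_id_eq_sInf, hfin.coe_toFinset, Ideal.sInf_minimalPrimes, hI.radical] at this

/-- If `I` is a radical ideal of the polynomial ring `ℂ[x₁, …, xₙ]`, then the ideal
`I · ℂ⟦x₁, …, xₙ⟧` generated by `I` in the ring of formal power series in `n` variables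
over `ℂ` is a radical ideal. -/
theorem isRadical_map_to_mvPowerSeries (n : ℕ) (hn : 1 ≤ n)
    (I : Ideal (MvPolynomial (Fin n) ℂ)) (hI : I.IsRadical) :
    (Ideal.map (MvPolynomial.coeToMvPowerSeries.ringHom :
        MvPolynomial (Fin n) ℂ →+* MvPowerSeries (Fin n) ℂ) I).IsRadical :=
  isRadical_map_of_isRadical I hI
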